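/- arXiv:math/0311372 — 8 statements merged into one kernel-verified Lean document; each statement's English description precedes it below -/
import Mathlib

section
/- For every n ≥ 0 and every x ∈ X (n+1), one has d n (l₂ (n+1) x) + l₂ n (d n x) = 0; that is, the boundary l₁ = d and the degree-preserving map l₂ anticommute in all degrees (equation l₁l₂ + l₂l₁ = 0 of Theorem 3). -/
theorem stmt_0
    (k : Type*) [Field k]
    (X : ℕ → Type*) [∀ n, AddCommGroup (X n)] [∀ n, Module k (X n)]
    (d : ∀ n, X (n + 1) →ₗ[k] X n)
    (hd : ∀ n (x : X (n + 2)), d n (d (n + 1) x) = 0)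
    (F : Type*) [AddCommGroup F] [Module k F]
    (η : X 0 →ₗ[k] F) (hη : Function.Surjective η)
    (hker : LinearMap.ker η = LinearMap.range (d 0))
    (lam : F →ₗ[k] X 0) (hlam : ∀ f, η (lam f) = f)
    (s : ∀ n, X n →ₗ[k] X (n + 1))
    (hs0 : ∀ x : X 0, lam (η x) - x = d 0 (s 0 x))
    (hs : ∀ n (x : X (n + 1)), -x = d (n + 1) (s (n + 1) x) + s n (d n x))
    (l₂ : ∀ n, X n →ₗ[k] X n)
    (hl₂B : ∀ x : X 0, x ∈ LinearMap.range (d 0) → l₂ 0 x ∈ LinearMap.range (d 0))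
    (hl₂sq : ∀ x : X 0, l₂ 0 (l₂ 0 x) ∈ LinearMap.range (d 0))
    (hl₂rec : ∀ n (x : X (n + 1)), l₂ (n + 1) x = s n (l₂ n (d n x)))
    (l₃ : ∀ n, X n →ₗ[k] X (n + 1))
    (hl₃0 : ∀ x : X 0, l₃ 0 x = s 0 (l₂ 0 (l₂ 0 x)))
    (hl₃rec : ∀ n (x : X (n + 1)),
      l₃ (n + 1) x = s (n + 1) (l₂ (n + 1) (l₂ (n + 1) x) + l₃ n (d n x)))
    : ∀ n (x : X (n + 1)), d n (l₂ (n + 1) x) + l₂ n (d n x) = 0 := by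
  intro n
  induction n with
  | zero =>
    intro x
    have hη0 : η (l₂ 0 (d 0 x)) = 0 := by
      rw [← LinearMap.mem_ker, hker]
      exact hl₂B _ ⟨x, rfl⟩
    rw [hl₂rec, ← hs0, hη0, map_zero, zero_sub, neg_add_cancel]
  | succ n ih =>
    intro x
    have hcycle : d n (l₂ (n + 1) (d (n + 1) x)) = 0 := by
      simpa [hd] using ih (d (n + 1) x)
    have hhomotopy := hs n (l₂ (n + 1) (d (n + 1) x))
    rw [hcycle, map_zero, add_zero] at hhomotopy
    rw [hl₂rec (n + 1), ← hhomotopy, neg_add_cancel]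
end

section
/- For every x ∈ X 0 one has l₂ 0 (l₂ 0 x) + d 0 (l₃ 0 x) = 0, and for every n ≥ 0 and every x ∈ X (n+1) one has l₂ (n+1) (l₂ (n+1) x) + d (n+1) (l₃ (n+1) x) + l₃ n (d n x) = 0; that is, the relation l₂² + l₁l₃ + l₃l₁ = 0 of Theorem 3 holds in all degrees. -/
theorem stmt_1
    (k : Type*) [Field k]
    (X : ℕ → Type*) [∀ n, AddCommGroup (X n)] [∀ n, Module k (X n)]
    (d : ∀ n, X (n + 1) →ₗ[k] X n)
    (hd : ∀ n (x : X (n + 2)), d n (d (n + 1) x) = 0)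
    (F : Type*) [AddCommGroup F] [Module k F]
    (η : X 0 →ₗ[k] F) (hη : Function.Surjective η)
    (hker : LinearMap.ker η = LinearMap.range (d 0))
    (lam : F →ₗ[k] X 0) (hlam : ∀ f, η (lam f) = f)
    (s : ∀ n, X n →ₗ[k] X (n + 1))
    (hs0 : ∀ x : X 0, lam (η x) - x = d 0 (s 0 x))
    (hs : ∀ n (x : X (n + 1)), -x = d (n + 1) (s (n + 1) x) + s n (d n x))
    (l₂ : ∀ n, X n →ₗ[k] X n)
    (hl₂B : ∀ x : X 0, x ∈ LinearMap.range (d 0) → l₂ 0 x ∈ LinearMap.range (d 0))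
    (hl₂sq : ∀ x : X 0, l₂ 0 (l₂ 0 x) ∈ LinearMap.range (d 0))
    (hl₂rec : ∀ n (x : X (n + 1)), l₂ (n + 1) x = s n (l₂ n (d n x)))
    (l₃ : ∀ n, X n →ₗ[k] X (n + 1))
    (hl₃0 : ∀ x : X 0, l₃ 0 x = s 0 (l₂ 0 (l₂ 0 x)))
    (hl₃rec : ∀ n (x : X (n + 1)),
      l₃ (n + 1) x = s (n + 1) (l₂ (n + 1) (l₂ (n + 1) x) + l₃ n (d n x)))
    : (∀ x : X 0, l₂ 0 (l₂ 0 x) + d 0 (l₃ 0 x) = 0) ∧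
    (∀ n (x : X (n + 1)),
      l₂ (n + 1) (l₂ (n + 1) x) + d (n + 1) (l₃ (n + 1) x) + l₃ n (d n x) = 0) := by
  have hB (y : X 0) (hy : y ∈ LinearMap.range (d 0)) : d 0 (s 0 y) = -y := by
    rw [← hker, LinearMap.mem_ker] at hy
    rw [← hs0, hy, map_zero, zero_sub]
  have hZ (n : ℕ) (y : X (n + 1)) (hy : d n y = 0) : d (n + 1) (s (n + 1) y) = -y := by
    rw [hs n y, hy, map_zero, add_zero]
  have hanti (n : ℕ) : ∀ x : X (n + 1), d n (l₂ (n + 1) x) = -l₂ n (d n x) := by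
    induction n with
    | zero =>
      intro x
      rw [hl₂rec, hB _ (hl₂B _ ⟨x, rfl⟩)]
    | succ n ih =>
      intro x
      rw [hl₂rec (n + 1), hZ]
      rw [ih, hd, map_zero, neg_zero]
  have hcomm (n : ℕ) (x : X (n + 1)) :
      d n (l₂ (n + 1) (l₂ (n + 1) x)) = l₂ n (l₂ n (d n x)) := by
    rw [hanti, hanti, map_neg, neg_neg]
  have hzero (x : X 0) : l₂ 0 (l₂ 0 x) + d 0 (l₃ 0 x) = 0 := by
    rw [hl₃0, hB _ (hl₂sq x), add_neg_cancel]
  have hstep (n : ℕ) (x : X (n + 1))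
      (h : l₂ n (l₂ n (d n x)) + d n (l₃ n (d n x)) = 0) :
      l₂ (n + 1) (l₂ (n + 1) x) + d (n + 1) (l₃ (n + 1) x) + l₃ n (d n x) = 0 := by
    rw [hl₃rec, hZ]
    · abel
    · rw [map_add, hcomm, h]
  refine ⟨hzero, fun n => ?_⟩
  induction n with
  | zero => exact fun x => hstep 0 x (hzero _)
  | succ n ih =>
    intro x
    refine hstep (n + 1) x ?_
    simpa only [hd, map_zero, add_zero] using ih (d (n + 1) x)
end

section
/- For every n ≥ 1 the map l₃ n : X n →ₗ[k] X (n+1) is identically zero; that is, the inductively defined map l₃ vanishes on all elements of positive degree (last statement of Theorem 3). -/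
theorem stmt_3
    (k : Type*) [Field k]
    (X : ℕ → Type*) [∀ n, AddCommGroup (X n)] [∀ n, Module k (X n)]
    (d : ∀ n, X (n + 1) →ₗ[k] X n)
    (hd : ∀ n (x : X (n + 2)), d n (d (n + 1) x) = 0)
    (F : Type*) [AddCommGroup F] [Module k F]
    (η : X 0 →ₗ[k] F) (hη : Function.Surjective η)
    (hker : LinearMap.ker η = LinearMap.range (d 0))
    (lam : F →ₗ[k] X 0) (hlam : ∀ f, η (lam f) = f)
    (s : ∀ n, X n →ₗ[k] X (n + 1))
    (hs0 : ∀ x : X 0, lam (η x) - x = d 0 (s 0 x))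
    (hs : ∀ n (x : X (n + 1)), -x = d (n + 1) (s (n + 1) x) + s n (d n x))
    (l₂ : ∀ n, X n →ₗ[k] X n)
    (hl₂B : ∀ x : X 0, x ∈ LinearMap.range (d 0) → l₂ 0 x ∈ LinearMap.range (d 0))
    (hl₂sq : ∀ x : X 0, l₂ 0 (l₂ 0 x) ∈ LinearMap.range (d 0))
    (hl₂rec : ∀ n (x : X (n + 1)), l₂ (n + 1) x = s n (l₂ n (d n x)))
    (l₃ : ∀ n, X n →ₗ[k] X (n + 1))
    (hl₃0 : ∀ x : X 0, l₃ 0 x = s 0 (l₂ 0 (l₂ 0 x)))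
    (hl₃rec : ∀ n (x : X (n + 1)),
      l₃ (n + 1) x = s (n + 1) (l₂ (n + 1) (l₂ (n + 1) x) + l₃ n (d n x)))
    : ∀ n, 1 ≤ n → l₃ n = 0 := by
  have hds : ∀ y ∈ LinearMap.range (d 0), d 0 (s 0 y) = -y := fun y hy => by
    have hy0 : η y = 0 := LinearMap.mem_ker.mp (hker ▸ hy)
    rw [← hs0, hy0, map_zero, zero_sub]
  have l₂_eq_zero : ∀ n (x : X (n + 2)), l₂ (n + 2) x = 0 := by
    intro n
    induction n with
    | zero => intro x; rw [hl₂rec, hl₂rec, hd]; simp only [map_zero]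
    | succ n ih => intro x; rw [hl₂rec, ih, map_zero]
  intro n hn
  induction n, hn using Nat.le_induction with
  | base =>
    ext x
    have hx : d 0 (s 0 (l₂ 0 (d 0 x))) = -l₂ 0 (d 0 x) :=
      hds _ (hl₂B _ (LinearMap.mem_range_self _ x))
    have h : l₂ 1 (l₂ 1 x) + l₃ 0 (d 0 x) = 0 := by
      rw [hl₂rec 0 x, hl₂rec, hx, hl₃0, map_neg, map_neg, neg_add_cancel]
    rw [hl₃rec, h, map_zero, LinearMap.zero_apply]
  | succ n hn ih =>
    obtain ⟨m, rfl⟩ := Nat.exists_eq_add_of_le' hn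
    ext x
    rw [hl₃rec, l₂_eq_zero, ih, LinearMap.zero_apply, add_zero, map_zero, LinearMap.zero_apply]
end

section
/- One has l₂ 1 ∘ l₃ 0 + l₃ 0 ∘ l₂ 0 = 0 on X 0 (the relation l₂l₃ + l₃l₂ = 0 of Theorem 3, which reduces to degree zero since l₃ vanishes in positive degrees), and l₃ 1 ∘ l₃ 0 = 0 (the relation l₃² = 0 of Theorem 3). -/
theorem stmt_4
    (k : Type*) [Field k]
    (X : ℕ → Type*) [∀ n, AddCommGroup (X n)] [∀ n, Module k (X n)]
    (d : ∀ n, X (n + 1) →ₗ[k] X n)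
    (hd : ∀ n (x : X (n + 2)), d n (d (n + 1) x) = 0)
    (F : Type*) [AddCommGroup F] [Module k F]
    (η : X 0 →ₗ[k] F) (hη : Function.Surjective η)
    (hker : LinearMap.ker η = LinearMap.range (d 0))
    (lam : F →ₗ[k] X 0) (hlam : ∀ f, η (lam f) = f)
    (s : ∀ n, X n →ₗ[k] X (n + 1))
    (hs0 : ∀ x : X 0, lam (η x) - x = d 0 (s 0 x))
    (hs : ∀ n (x : X (n + 1)), -x = d (n + 1) (s (n + 1) x) + s n (d n x))
    (l₂ : ∀ n, X n →ₗ[k] X n)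
    (hl₂B : ∀ x : X 0, x ∈ LinearMap.range (d 0) → l₂ 0 x ∈ LinearMap.range (d 0))
    (hl₂sq : ∀ x : X 0, l₂ 0 (l₂ 0 x) ∈ LinearMap.range (d 0))
    (hl₂rec : ∀ n (x : X (n + 1)), l₂ (n + 1) x = s n (l₂ n (d n x)))
    (l₃ : ∀ n, X n →ₗ[k] X (n + 1))
    (hl₃0 : ∀ x : X 0, l₃ 0 x = s 0 (l₂ 0 (l₂ 0 x)))
    (hl₃rec : ∀ n (x : X (n + 1)),
      l₃ (n + 1) x = s (n + 1) (l₂ (n + 1) (l₂ (n + 1) x) + l₃ n (d n x)))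
    : (∀ x : X 0, l₂ 1 (l₃ 0 x) + l₃ 0 (l₂ 0 x) = 0) ∧ (∀ x : X 0, l₃ 1 (l₃ 0 x) = 0) := by
  have hds (b : X 0) (hb : b ∈ LinearMap.range (d 0)) : d 0 (s 0 b) = -b := by
    rw [← hker, LinearMap.mem_ker] at hb
    rw [← hs0, hb, map_zero, zero_sub]
  have hl₂s (b : X 0) (hb : b ∈ LinearMap.range (d 0)) :
      l₂ 1 (s 0 b) = -s 0 (l₂ 0 b) := by
    rw [hl₂rec, hds b hb, map_neg, map_neg]
  refine ⟨fun x => ?_, fun x => ?_⟩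
  · rw [hl₃0, hl₂s _ (hl₂sq x), hl₃0, neg_add_cancel]
  · have hb := hl₂sq x
    rw [hl₃rec, hl₃0 x, hds _ hb, hl₂s _ hb, map_neg, hl₂s _ (hl₂B _ hb), neg_neg, map_neg,
      hl₃0, add_neg_cancel, map_zero]
end

section
/- (Theorem 3.) Let T := ⨁_{n∈ℕ} X n be the total space, and let l : T →ₗ[k] T be the linear map whose restriction to the summand X n is given by (for n ≥ 1) the component d (n−1) into X (n−1), plus l₂ n into X n, plus l₃ n into X (n+1) (for n = 0 only the components l₂ 0 and l₃ 0). Then l ∘ l = 0; that is, the sum l = l₁ + l₂ + l₃ is a nilpotent (square-zero) operator on X, so (X, l) is a chain extension of B by (F, D_F) where D_F is the restriction of l₂⁰ to F. -/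
theorem stmt_5
    (k : Type*) [Field k]
    (X : ℕ → Type*) [∀ n, AddCommGroup (X n)] [∀ n, Module k (X n)]
    (d : ∀ n, X (n + 1) →ₗ[k] X n)
    (hd : ∀ n (x : X (n + 2)), d n (d (n + 1) x) = 0)
    (F : Type*) [AddCommGroup F] [Module k F]
    (η : X 0 →ₗ[k] F) (hη : Function.Surjective η)
    (hker : LinearMap.ker η = LinearMap.range (d 0))
    (lam : F →ₗ[k] X 0) (hlam : ∀ f, η (lam f) = f)
    (s : ∀ n, X n →ₗ[k] X (n + 1))
    (hs0 : ∀ x : X 0, lam (η x) - x = d 0 (s 0 x))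
    (hs : ∀ n (x : X (n + 1)), -x = d (n + 1) (s (n + 1) x) + s n (d n x))
    (l₂ : ∀ n, X n →ₗ[k] X n)
    (hl₂B : ∀ x : X 0, x ∈ LinearMap.range (d 0) → l₂ 0 x ∈ LinearMap.range (d 0))
    (hl₂sq : ∀ x : X 0, l₂ 0 (l₂ 0 x) ∈ LinearMap.range (d 0))
    (hl₂rec : ∀ n (x : X (n + 1)), l₂ (n + 1) x = s n (l₂ n (d n x)))
    (l₃ : ∀ n, X n →ₗ[k] X (n + 1))
    (hl₃0 : ∀ x : X 0, l₃ 0 x = s 0 (l₂ 0 (l₂ 0 x)))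
    (hl₃rec : ∀ n (x : X (n + 1)),
      l₃ (n + 1) x = s (n + 1) (l₂ (n + 1) (l₂ (n + 1) x) + l₃ n (d n x)))
    (l : DirectSum ℕ X →ₗ[k] DirectSum ℕ X)
    (hl0 : ∀ x : X 0,
      l (DirectSum.lof k ℕ X 0 x) =
        DirectSum.lof k ℕ X 0 (l₂ 0 x) + DirectSum.lof k ℕ X 1 (l₃ 0 x))
    (hlsucc : ∀ n (x : X (n + 1)),
      l (DirectSum.lof k ℕ X (n + 1) x) =
        DirectSum.lof k ℕ X n (d n x) + DirectSum.lof k ℕ X (n + 1) (l₂ (n + 1) x) +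
          DirectSum.lof k ℕ X (n + 2) (l₃ (n + 1) x))
    : l ∘ₗ l = 0 := by
  have d_l₂ : ∀ n (x : X (n + 1)), d n (l₂ (n + 1) x) = -l₂ n (d n x) := by
    intro n
    induction n with
    | zero =>
      intro x
      have hx : η (l₂ 0 (d 0 x)) = 0 :=
        LinearMap.mem_ker.mp (hker ▸ hl₂B _ (LinearMap.mem_range_self _ x))
      rw [hl₂rec, ← hs0, hx, map_zero, zero_sub]
    | succ n ih =>
      intro x
      have h := hs n (l₂ (n + 1) (d (n + 1) x))
      rw [ih, hd, map_zero, neg_zero, map_zero, add_zero] at h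
      rw [hl₂rec, h]
  have d_l₃_zero : ∀ x, d 0 (l₃ 0 x) = -l₂ 0 (l₂ 0 x) := by
    intro x
    have hx : η (l₂ 0 (l₂ 0 x)) = 0 := LinearMap.mem_ker.mp (hker ▸ hl₂sq x)
    rw [hl₃0, ← hs0, hx, map_zero, zero_sub]
  have d_l₃ : ∀ n (x : X (n + 1)),
      d (n + 1) (l₃ (n + 1) x) = -(l₂ (n + 1) (l₂ (n + 1) x) + l₃ n (d n x)) := by
    intro n
    induction n with
    | zero =>
      intro x
      have h := hs 0 (l₂ 1 (l₂ 1 x) + l₃ 0 (d 0 x))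
      rw [map_add (d 0), d_l₂, d_l₂, map_neg, neg_neg, d_l₃_zero, add_neg_cancel, map_zero,
        add_zero] at h
      rw [hl₃rec, h]
    | succ n ih =>
      intro x
      have h := hs (n + 1) (l₂ (n + 2) (l₂ (n + 2) x) + l₃ (n + 1) (d (n + 1) x))
      rw [map_add (d (n + 1)), d_l₂, d_l₂, map_neg, neg_neg, ih, hd, map_zero, add_zero,
        add_neg_cancel, map_zero, add_zero] at h
      rw [hl₃rec, h]
  have l₂_l₃ : ∀ n (x : X n), l₂ (n + 1) (l₃ n x) = -l₃ n (l₂ n x) := by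
    intro n
    induction n with
    | zero =>
      intro x
      rw [hl₂rec, d_l₃_zero, hl₃0, map_neg, map_neg]
    | succ n ih =>
      intro x
      rw [hl₂rec, d_l₃, hl₃rec n (l₂ (n + 1) x), d_l₂, map_neg, map_add, ih, map_neg, map_neg]
  have l₃_l₃ : ∀ n (x : X n), l₃ (n + 1) (l₃ n x) = 0 := by
    intro n
    induction n with
    | zero =>
      intro x
      rw [hl₃rec, d_l₃_zero, l₂_l₃, map_neg, l₂_l₃, neg_neg, map_neg, add_neg_cancel, map_zero]
    | succ n ih =>
      intro x
      rw [hl₃rec, d_l₃, l₂_l₃, map_neg, l₂_l₃, neg_neg, map_neg, map_add (l₃ (n + 1)), ih,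
        add_zero, add_neg_cancel, map_zero]
  refine DirectSum.linearMap_ext k fun n => LinearMap.ext fun x => ?_
  rcases n with _ | _ | n
  · simp only [LinearMap.comp_apply, LinearMap.zero_apply, map_add, hl0, hlsucc, d_l₃_zero,
      l₂_l₃, l₃_l₃, map_neg, map_zero]
    abel
  · simp only [LinearMap.comp_apply, LinearMap.zero_apply, map_add, hl0, hlsucc, d_l₂, d_l₃,
      l₂_l₃, l₃_l₃, map_neg, map_zero]
    abel
  · simp only [LinearMap.comp_apply, LinearMap.zero_apply, map_add, hlsucc, hd, d_l₂, d_l₃,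
      l₂_l₃, l₃_l₃, map_neg, map_zero]
    abel
end

section
/- For every f, a, b one has ⁅⁅f, G a⁆, G b⁆ − ⁅⁅f, G b⁆, G a⁆ − Σ_{c} C c a b * ⁅f, G c⁆ = Σ_{c} ⁅f, C c a b⁆ * G c; in particular the left-hand side lies in the ideal N, which is the statement that the longitudinal differential satisfies d²f ∈ N ⊗ C(η) for every smooth function f (d²f = −(1/2)⁅f, C^c_{ab}⁆ G_c η^b η^a). -/
theorem stmt_8
    (R : Type*) [CommRing R]
    (br : R → R → R)
    (hadd₁ : ∀ a b c : R, br (a + b) c = br a c + br b c)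
    (hadd₂ : ∀ a b c : R, br a (b + c) = br a b + br a c)
    (halt : ∀ a : R, br a a = 0)
    (hjac : ∀ a b c : R, br a (br b c) + br b (br c a) + br c (br a b) = 0)
    (hleib : ∀ a b c : R, br (a * b) c = a * br b c + b * br a c)
    (ι : Type*) [Fintype ι]
    (G : ι → R) (C : ι → ι → ι → R)
    (hGC : ∀ a b : ι, br (G a) (G b) = ∑ c, C c a b * G c)
    : ∀ (f : R) (a b : ι),
      (br (br f (G a)) (G b) - br (br f (G b)) (G a) - ∑ c, C c a b * br f (G c)
        = ∑ c, br f (C c a b) * G c) ∧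
      (br (br f (G a)) (G b) - br (br f (G b)) (G a) - ∑ c, C c a b * br f (G c)
        ∈ Ideal.span (Set.range G)) := by
  intro f a b
  have hskew (x y : R) : br x y = -br y x := by
    have h := halt (x + y)
    rw [hadd₁, hadd₂, hadd₂, halt, halt] at h
    linear_combination h
  let ad (x : R) : R →+ R := AddMonoidHom.mk' (br x) (hadd₂ x)
  have hneg (x y : R) : br x (-y) = -br x y := map_neg (ad x) y
  have hsum (x : R) (g : ι → R) : br x (∑ c, g c) = ∑ c, br x (g c) :=
    map_sum (ad x) g Finset.univ
  have hleib₂ (x y z : R) : br x (y * z) = y * br x z + br x y * z := by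
    rw [hskew x (y * z), hleib, hskew x y, hskew x z]
    ring
  have hcomm : br (br f (G a)) (G b) - br (br f (G b)) (G a) = br f (br (G a) (G b)) := by
    have h := hjac f (G a) (G b)
    rw [hskew (G b) f, hneg] at h
    rw [hskew (br f (G a)), hskew (br f (G b))]
    linear_combination -h
  have key : br (br f (G a)) (G b) - br (br f (G b)) (G a) - ∑ c, C c a b * br f (G c)
      = ∑ c, br f (C c a b) * G c := by
    rw [hcomm, hGC, hsum]
    simp only [hleib₂, Finset.sum_add_distrib, add_sub_cancel_left]
  refine ⟨key, ?_⟩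
  rw [key]
  exact Ideal.sum_mem _ fun c _ => Ideal.mul_mem_left _ _ (Ideal.subset_span ⟨c, rfl⟩)
end

section
/- For all a, p, q ∈ ι, the full antisymmetrization over the three indices vanishes: Σ_{σ ∈ Equiv.Perm (Fin 3)} sign(σ) · Σ_{c} ( Σ_{b} C c (v σ 0) b * C b (v σ 1) (v σ 2) + ⁅C c (v σ 0) (v σ 2), G (v σ 1)⁆ ) * G c = 0, where (v σ 0, v σ 1, v σ 2) denotes the σ-permutation of (a, p, q). (This is the identity {C^c_{ab} C^b_{pq} + ⁅C^c_{aq}, G_p⁆} G_c η^a η^p η^q = −⁅⁅G_a, G_p⁆, G_q⁆ η^a η^p η^q = 0 used to show d²η^c ∈ N ⊗ C(η).) -/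
/-- The signed sum over the permutations of three indices, written out. -/
theorem sum_perm_fin_three_sign_smul {M : Type*} [AddCommGroup M] (f : Fin 3 → Fin 3 → Fin 3 → M) :
    ∑ σ : Equiv.Perm (Fin 3), (Equiv.Perm.sign σ : ℤ) • f (σ 0) (σ 1) (σ 2) =
      f 0 1 2 - f 1 0 2 - f 2 1 0 - f 0 2 1 + f 1 2 0 + f 2 0 1 := by
  have h : (Finset.univ : Finset (Equiv.Perm (Fin 3))) =
      {1, Equiv.swap 0 1, Equiv.swap 0 2, Equiv.swap 1 2,
        Equiv.swap 0 1 * Equiv.swap 1 2, Equiv.swap 1 2 * Equiv.swap 0 1} := by decide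
  have e₁ : (Equiv.swap 0 1 : Equiv.Perm (Fin 3)) 2 = 2 := by decide
  have e₂ : (Equiv.swap 0 2 : Equiv.Perm (Fin 3)) 1 = 1 := by decide
  have e₃ : (Equiv.swap 1 2 : Equiv.Perm (Fin 3)) 0 = 0 := by decide
  rw [h, Finset.sum_insert (by decide), Finset.sum_insert (by decide),
    Finset.sum_insert (by decide), Finset.sum_insert (by decide),
    Finset.sum_insert (by decide), Finset.sum_singleton]
  simp [e₁, e₂, e₃]
  abel

theorem stmt_9
    (R : Type*) [CommRing R]
    (br : R → R → R)
    (hadd₁ : ∀ a b c : R, br (a + b) c = br a c + br b c)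
    (hadd₂ : ∀ a b c : R, br a (b + c) = br a b + br a c)
    (halt : ∀ a : R, br a a = 0)
    (hjac : ∀ a b c : R, br a (br b c) + br b (br c a) + br c (br a b) = 0)
    (hleib : ∀ a b c : R, br (a * b) c = a * br b c + b * br a c)
    (ι : Type*) [Fintype ι]
    (G : ι → R) (C : ι → ι → ι → R)
    (hGC : ∀ a b : ι, br (G a) (G b) = ∑ c, C c a b * G c)
    : ∀ a p q : ι,
      ∑ σ : Equiv.Perm (Fin 3), (Equiv.Perm.sign σ : ℤ) •
        ∑ c, ((∑ b, C c (![a, p, q] (σ 0)) b * C b (![a, p, q] (σ 1)) (![a, p, q] (σ 2))) +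
              br (C c (![a, p, q] (σ 0)) (![a, p, q] (σ 2))) (G (![a, p, q] (σ 1)))) * G c
        = 0 := by
  intro a p q
  let D : R → R →+ R := fun y => AddMonoidHom.mk' (fun x => br x y) fun u v => hadd₁ u v y
  have hanti (x y : R) : br x y = -br y x := by
    have h := halt (x + y)
    rw [hadd₁, hadd₂, hadd₂, halt, halt] at h
    linear_combination h
  let S : ι → ι → ι → R := fun x y z => ∑ b, C b y z * br (G x) (G b)
  have hT (x y z : ι) :
      ∑ c, ((∑ b, C c x b * C b y z) + br (C c x z) (G y)) * G c =
        S x y z + S y x z + br (br (G x) (G z)) (G y) := by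
    have h₁ : ∑ c, (∑ b, C c x b * C b y z) * G c = S x y z := by
      simp only [S, hGC, Finset.sum_mul, Finset.mul_sum]
      rw [Finset.sum_comm]
      exact Finset.sum_congr rfl fun _ _ => Finset.sum_congr rfl fun _ _ => by ring
    have h₂ : br (br (G x) (G z)) (G y) = ∑ c, br (C c x z) (G y) * G c - S y x z := by
      rw [hGC x z]
      refine (map_sum (D (G y)) _ _).trans ?_
      rw [← Finset.sum_sub_distrib]
      refine Finset.sum_congr rfl fun c _ => (hleib _ _ _).trans ?_
      rw [hanti (G c) (G y)]
      ring
    simp only [add_mul, Finset.sum_add_distrib]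
    rw [h₁, h₂]
    ring
  simp only [hT]
  rw [sum_perm_fin_three_sign_smul fun i j k =>
    S (![a, p, q] i) (![a, p, q] j) (![a, p, q] k) +
      S (![a, p, q] j) (![a, p, q] i) (![a, p, q] k) +
      br (br (G (![a, p, q] i)) (G (![a, p, q] k))) (G (![a, p, q] j))]
  simp only [Matrix.cons_val]
  have hjac' (x y z : R) : br (br x y) z + br (br y z) x + br (br z x) y = 0 := by
    rw [hanti (br x y), hanti (br y z), hanti (br z x)]
    linear_combination -hjac x y z
  linear_combination hjac' (G a) (G q) (G p) - hjac' (G a) (G p) (G q)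
end

section
/- For every a ∈ ι one has ⁅f, G a⁆ ∈ N whenever f ∈ N; consequently, for each a the map R ⧸ N → R ⧸ N sending f + N to ⁅f, G a⁆ + N is a well-defined additive map, and it is a derivation of the quotient ring: it sends (f*g) + N to f*⁅g, G a⁆ + g*⁅f, G a⁆ + N. -/
/-- An additive endomorphism preserving an ideal descends to the quotient ring. -/
theorem Ideal.Quotient.exists_addMonoidHom_mk {R : Type*} [CommRing R] (I : Ideal R)
    (d : R →+ R) (hd : ∀ f ∈ I, d f ∈ I) :
    ∃ D : R ⧸ I →+ R ⧸ I, ∀ f : R, D (Ideal.Quotient.mk I f) = Ideal.Quotient.mk I (d f) :=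
  ⟨QuotientAddGroup.map I.toAddSubgroup I.toAddSubgroup d hd, fun _ => rfl⟩

theorem stmt_10
    (R : Type*) [CommRing R]
    (br : R → R → R)
    (hadd₁ : ∀ a b c : R, br (a + b) c = br a c + br b c)
    (hadd₂ : ∀ a b c : R, br a (b + c) = br a b + br a c)
    (halt : ∀ a : R, br a a = 0)
    (hjac : ∀ a b c : R, br a (br b c) + br b (br c a) + br c (br a b) = 0)
    (hleib : ∀ a b c : R, br (a * b) c = a * br b c + b * br a c)
    (ι : Type*) [Fintype ι]
    (G : ι → R) (C : ι → ι → ι → R)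
    (hGC : ∀ a b : ι, br (G a) (G b) = ∑ c, C c a b * G c)
    : ∀ a : ι,
      (∀ f : R, f ∈ Ideal.span (Set.range G) → br f (G a) ∈ Ideal.span (Set.range G)) ∧
      ∃ D : R ⧸ Ideal.span (Set.range G) →+ R ⧸ Ideal.span (Set.range G),
        (∀ f : R, D (Ideal.Quotient.mk (Ideal.span (Set.range G)) f) =
          Ideal.Quotient.mk (Ideal.span (Set.range G)) (br f (G a))) ∧
        (∀ f g : R, D (Ideal.Quotient.mk (Ideal.span (Set.range G)) (f * g)) =
          Ideal.Quotient.mk (Ideal.span (Set.range G)) (f * br g (G a) + g * br f (G a))) := by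
  intro a
  have hzero : br 0 (G a) = 0 := by simpa using hadd₁ 0 0 (G a)
  have hmem : ∀ f ∈ Ideal.span (Set.range G), br f (G a) ∈ Ideal.span (Set.range G) := by
    intro f hf
    induction hf using Submodule.span_induction with
    | mem x hx =>
      obtain ⟨b, rfl⟩ := hx
      rw [hGC]
      exact Ideal.sum_mem _ fun c _ =>
        Ideal.mul_mem_left _ _ (Ideal.subset_span (Set.mem_range_self c))
    | zero => rw [hzero]; exact Ideal.zero_mem _
    | add x y _ _ hx hy => rw [hadd₁]; exact Ideal.add_mem _ hx hy
    | smul r x hx ih =>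
      rw [smul_eq_mul, hleib]
      exact Ideal.add_mem _ (Ideal.mul_mem_left _ _ ih) (Ideal.mul_mem_right _ _ hx)
  obtain ⟨D, hD⟩ := Ideal.Quotient.exists_addMonoidHom_mk (Ideal.span (Set.range G))
    { toFun := fun f => br f (G a)
      map_zero' := hzero
      map_add' := fun f g => hadd₁ f g (G a) } hmem
  exact ⟨hmem, D, hD, fun f g => (hD (f * g)).trans (congrArg _ (hleib f g (G a)))⟩
end
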